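/- Let (a_n)_{n≥1} be a strictly increasing sequence of positive integers and let ε > 0. Then for Lebesgue-almost all α ∈ [0,1], the inequality δ_min^α(N) ≤ N^ε / C_N holds for all except finitely many N. -/

import Mathlib

open MeasureTheory Filter

/-- Distance to the nearest integer. -/
noncomputable def nint (x : ℝ) : ℝ := |x - round x|

/-- `δ_min^α(N) = min { ‖(a_m - a_n) α‖ : 1 ≤ m, n ≤ N, m ≠ n }`. -/
noncomputable def deltaMin (a : ℕ → ℕ) (α : ℝ) (N : ℕ) : ℝ :=
  sInf {x : ℝ | ∃ m n : ℕ, 1 ≤ m ∧ m ≤ N ∧ 1 ≤ n ∧ n ≤ N ∧ m ≠ n ∧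
    x = nint (((a m : ℝ) - (a n : ℝ)) * α)}

/-- `C_N = #(A_N - A_N)` where `A_N = {a_1, …, a_N}`. -/
noncomputable def diffCard (a : ℕ → ℕ) (N : ℕ) : ℕ :=
  (((Finset.Icc 1 N) ×ˢ (Finset.Icc 1 N)).image
    (fun p : ℕ × ℕ => (a p.1 : ℤ) - (a p.2 : ℤ))).card

/-- `log x`, read as `max {1, log x}`. -/
noncomputable def L (x : ℝ) : ℝ := max 1 (Real.log x)

/-- `log₂ x = log log x`, with the `max {1, ·}` convention. -/
noncomputable def LL (x : ℝ) : ℝ := L (L x)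

/-- The divisor bound `d(n) ≪ n ^ η`. -/
theorem exists_card_divisors_le_mul_rpow {η : ℝ} (hη : 0 < η) :
    ∃ C : ℝ, 1 ≤ C ∧ ∀ n : ℕ, n ≠ 0 → (n.divisors.card : ℝ) ≤ C * (n : ℝ) ^ η := by
  set A : ℝ := max 1 (1 / (η * Real.log 2)) with hA
  have hA1 : 1 ≤ A := le_max_left _ _
  have hl2 : 0 < Real.log 2 := Real.log_pos (by norm_num)
  obtain ⟨P, hP⟩ := exists_nat_ge ((2 : ℝ) ^ (1 / η))
  refine ⟨A ^ P, one_le_pow₀ hA1, fun n hn => ?_⟩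
  have hfac : (n : ℝ) ^ η = ∏ p ∈ n.primeFactors, ((p : ℝ) ^ η) ^ (n.factorization p) := by
    conv_lhs => rw [← Nat.prod_factorization_pow_eq_self hn]
    rw [Finsupp.prod, Nat.support_factorization]
    push_cast
    rw [← Real.finsetProd_rpow _ _ (fun i _ => by positivity)]
    refine Finset.prod_congr rfl fun p _ => ?_
    rw [← Real.rpow_natCast, ← Real.rpow_natCast, ← Real.rpow_mul (by positivity),
      ← Real.rpow_mul (by positivity), mul_comm]
  have hterm : ∀ p ∈ n.primeFactors, ((n.factorization p + 1 : ℕ) : ℝ) ≤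
      (if p < P then A else 1) * ((p : ℝ) ^ η) ^ (n.factorization p) := by
    intro p hp
    have hp2 : (2 : ℝ) ≤ p := by exact_mod_cast (Nat.prime_of_mem_primeFactors hp).two_le
    generalize n.factorization p = e
    split_ifs with h
    · have h1 : ((2 : ℝ) ^ η) ^ e ≤ ((p : ℝ) ^ η) ^ e := by gcongr
      have h2 : ((2 : ℝ) ^ η) ^ e = Real.exp (e * (η * Real.log 2)) := by
        rw [Real.rpow_def_of_pos (by norm_num), ← Real.exp_nat_mul, mul_comm (Real.log 2)]
      have h3 := Real.add_one_le_exp (e * (η * Real.log 2))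
      have h4 : 1 ≤ A * (η * Real.log 2) := by
        have : 1 / (η * Real.log 2) ≤ A := le_max_right _ _
        rwa [div_le_iff₀ (by positivity)] at this
      push_cast
      calc (e : ℝ) + 1 ≤ e * (A * (η * Real.log 2)) + A := by
            nlinarith [Nat.cast_nonneg (α := ℝ) e]
        _ = A * (e * (η * Real.log 2) + 1) := by ring
        _ ≤ A * ((p : ℝ) ^ η) ^ e := by
            gcongr
            linarith
    · rw [one_mul]
      have hpP : (2 : ℝ) ^ (1 / η) ≤ p := hP.trans (by exact_mod_cast not_lt.1 h)
      have h1 : (2 : ℝ) ≤ (p : ℝ) ^ η := by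
        calc (2 : ℝ) = ((2 : ℝ) ^ (1 / η)) ^ η := by
              rw [← Real.rpow_mul (by norm_num), one_div_mul_cancel hη.ne', Real.rpow_one]
          _ ≤ _ := by gcongr
      calc ((e + 1 : ℕ) : ℝ) ≤ (2 : ℝ) ^ e := by exact_mod_cast Nat.lt_two_pow_self
        _ ≤ _ := by gcongr
  rw [Nat.card_divisors hn, hfac]
  push_cast [] at hterm ⊢
  refine (Finset.prod_le_prod (fun i _ => by positivity) hterm).trans ?_
  rw [Finset.prod_mul_distrib]
  gcongr
  rw [Finset.prod_ite, Finset.prod_const_one, mul_one, Finset.prod_const]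
  refine pow_le_pow_right₀ hA1 ?_
  calc _ ≤ (Finset.range P).card := Finset.card_le_card fun x hx => by
        simpa using (Finset.mem_filter.1 hx).2
    _ = P := Finset.card_range P

theorem sum_dirichletCharacter_norm_sq {ι : Type*} (I : Finset ι) (c : ι → ℝ) (f : ι → ℕ)
    {q : ℕ} [Fact q.Prime] (hf : ∀ i ∈ I, 0 < f i ∧ f i < q) :
    ∑ χ : DirichletCharacter ℂ q, ‖∑ i ∈ I, (c i : ℂ) * χ (f i)‖ ^ 2 =
      q.totient * ∑ i ∈ I, ∑ j ∈ I, if f i = f j then c i * c j else 0 := by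
  have key : ∀ i ∈ I, ∀ j ∈ I, ∑ χ : DirichletCharacter ℂ q, star (χ (f i)) * χ (f j) =
      if f i = f j then (q.totient : ℂ) else 0 := by
    intro i hi j hj
    have hu : IsUnit ((f i : ℕ) : ZMod q) := by
      rw [ZMod.isUnit_iff_coprime]
      exact (Nat.coprime_of_lt_prime (hf i hi).1.ne' (hf i hi).2 Fact.out).symm
    have h := DirichletCharacter.sum_char_inv_mul_char_eq ℂ hu (f j : ZMod q)
    have heq : ((f i : ZMod q) = f j) ↔ f i = f j := by
      rw [ZMod.natCast_eq_natCast_iff', Nat.mod_eq_of_lt (hf i hi).2,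
        Nat.mod_eq_of_lt (hf j hj).2]
    simp only [heq] at h
    rw [← h]
    refine Finset.sum_congr rfl fun χ _ => ?_
    rw [← MulChar.inv_apply', MulChar.star_apply']
  have hc : (∑ χ : DirichletCharacter ℂ q, ((‖∑ i ∈ I, (c i : ℂ) * χ (f i)‖ ^ 2 : ℝ) : ℂ)) =
      q.totient * ∑ i ∈ I, ∑ j ∈ I, if f i = f j then ((c i * c j : ℝ) : ℂ) else 0 := by
    have h1 : ∀ χ : DirichletCharacter ℂ q, ((‖∑ i ∈ I, (c i : ℂ) * χ (f i)‖ ^ 2 : ℝ) : ℂ) =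
        ∑ i ∈ I, ∑ j ∈ I, (c i : ℂ) * c j * (star (χ (f i)) * χ (f j)) := by
      intro χ
      push_cast
      rw [← Complex.conj_mul', map_sum, Finset.sum_mul_sum]
      refine Finset.sum_congr rfl fun i _ => Finset.sum_congr rfl fun j _ => ?_
      rw [map_mul, Complex.conj_ofReal]
      simp only [Complex.star_def]
      ring
    simp_rw [h1]
    rw [Finset.sum_comm, Finset.mul_sum]
    refine Finset.sum_congr rfl fun i hi => ?_
    rw [Finset.sum_comm, Finset.mul_sum]
    refine Finset.sum_congr rfl fun j hj => ?_
    rw [← Finset.mul_sum, key i hi j hj]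
    split_ifs <;> push_cast <;> ring
  apply Complex.ofReal_injective
  push_cast at hc ⊢
  rw [hc]
  congr 1
  refine Finset.sum_congr rfl fun i _ => Finset.sum_congr rfl fun j _ => ?_
  split_ifs <;> simp

theorem sum_mul_pow_le {ι : Type*} (s : Finset ι) (w z : ι → ℝ) (hw : ∀ i ∈ s, 0 ≤ w i)
    (hz : ∀ i ∈ s, 0 ≤ z i) (hpos : 0 < ∑ i ∈ s, w i) (k : ℕ) :
    (∑ i ∈ s, w i * z i) ^ (k + 1) ≤ (∑ i ∈ s, w i) ^ k * ∑ i ∈ s, w i * z i ^ (k + 1) := by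
  set W := ∑ i ∈ s, w i
  have h := Real.pow_arith_mean_le_arith_mean_pow s (fun i => w i / W) z
    (fun i hi => div_nonneg (hw i hi) hpos.le)
    (by rw [← Finset.sum_div, div_self hpos.ne']) hz (k + 1)
  simp only [div_mul_eq_mul_div, ← Finset.sum_div] at h
  rw [div_pow, div_le_div_iff₀ (by positivity) hpos, pow_succ W] at h
  nlinarith

/-- The weighted count of solutions of `z * a = w * b` with `z, w ∈ D` and `a, b ≤ K` is controlled
by the `2 k`-th moment of the associated Dirichlet polynomial. -/
theorem pow_sum_ratio_le (D : Finset ℕ) (hD : ∀ z ∈ D, 0 < z) (hne : D.Nonempty) (K k : ℕ)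
    (c : ℕ → ℝ) :
    (∑ x ∈ D ×ˢ Finset.Icc 1 K, ∑ y ∈ D ×ˢ Finset.Icc 1 K,
        if x.1 * x.2 = y.1 * y.2 then c x.2 * c y.2 else 0) ^ (k + 1) ≤
      (D.card : ℝ) ^ (k + 2) *
        ∑ u ∈ Fintype.piFinset (fun _ : Fin (k + 1) => Finset.Icc 1 K),
          ∑ v ∈ Fintype.piFinset (fun _ : Fin (k + 1) => Finset.Icc 1 K),
            if ∏ i, u i = ∏ i, v i then (∏ i, c (u i)) * ∏ i, c (v i) else 0 := by
  obtain ⟨q, hq, hqp⟩ := Nat.exists_infinite_primes (D.sup id + D.sup id * K + K ^ (k + 1) + 1)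
  have hsup : ∀ z ∈ D, z ≤ D.sup id := fun z hz => Finset.le_sup (f := id) hz
  have : Fact q.Prime := ⟨hqp⟩
  have hphi : (0 : ℝ) < q.totient := by exact_mod_cast Nat.totient_pos.2 hqp.pos
  have hcard : (0 : ℝ) < D.card := by exact_mod_cast hne.card_pos
  set S : DirichletCharacter ℂ q → ℂ := fun χ => ∑ z ∈ D, ((1 : ℝ) : ℂ) * χ (z : ℕ) with hS
  set F : DirichletCharacter ℂ q → ℂ := fun χ => ∑ a ∈ Finset.Icc 1 K, (c a : ℂ) * χ (a : ℕ)
    with hF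
  have h1 : ∑ χ, ‖S χ‖ ^ 2 = q.totient * D.card := by
    rw [sum_dirichletCharacter_norm_sq D (fun _ => 1) (fun z => z)
      (fun z hz => ⟨hD z hz, by have := hsup z hz; have := Nat.zero_le (D.sup id * K); omega⟩)]
    simp
  have h2 : ∑ χ, ‖S χ‖ ^ 2 * ‖F χ‖ ^ 2 = q.totient * ∑ x ∈ D ×ˢ Finset.Icc 1 K,
      ∑ y ∈ D ×ˢ Finset.Icc 1 K, if x.1 * x.2 = y.1 * y.2 then c x.2 * c y.2 else 0 := by
    rw [← sum_dirichletCharacter_norm_sq (D ×ˢ Finset.Icc 1 K) (fun x => c x.2)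
      (fun x => x.1 * x.2)]
    · refine Finset.sum_congr rfl fun χ _ => ?_
      rw [← mul_pow, ← norm_mul, hS, hF, Finset.sum_mul_sum, Finset.sum_product]
      congr 2
      refine Finset.sum_congr rfl fun z _ => Finset.sum_congr rfl fun a _ => ?_
      push_cast
      rw [map_mul]
      ring
    · intro x hx
      rw [Finset.mem_product, Finset.mem_Icc] at hx
      refine ⟨Nat.mul_pos (hD _ hx.1) hx.2.1, ?_⟩
      have := Nat.mul_le_mul (hsup _ hx.1) hx.2.2
      omega
  have h3 : ∑ χ, (‖F χ‖ ^ 2) ^ (k + 1) = q.totient *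
      ∑ u ∈ Fintype.piFinset (fun _ : Fin (k + 1) => Finset.Icc 1 K),
          ∑ v ∈ Fintype.piFinset (fun _ : Fin (k + 1) => Finset.Icc 1 K),
            if ∏ i, u i = ∏ i, v i then (∏ i, c (u i)) * ∏ i, c (v i) else 0 := by
    rw [← sum_dirichletCharacter_norm_sq
      (Fintype.piFinset (fun _ : Fin (k + 1) => Finset.Icc 1 K)) (fun u => ∏ i, c (u i))
      (fun u => ∏ i, u i)]
    · refine Finset.sum_congr rfl fun χ _ => ?_
      rw [← pow_mul, mul_comm 2, pow_mul, ← norm_pow, hF]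
      congr 2
      have := Finset.prod_univ_sum (fun _ : Fin (k + 1) => Finset.Icc 1 K)
        (fun _ a => (c a : ℂ) * χ (a : ℕ))
      rw [Finset.prod_const, Finset.card_univ, Fintype.card_fin] at this
      rw [this]
      refine Finset.sum_congr rfl fun u _ => ?_
      rw [Finset.prod_mul_distrib]
      push_cast
      rw [map_prod]
    · intro u hu
      simp only [Fintype.mem_piFinset, Finset.mem_Icc] at hu
      refine ⟨Finset.prod_pos fun i _ => (hu i).1, ?_⟩
      have : ∏ i, u i ≤ K ^ (k + 1) := by
        simpa using Finset.prod_le_pow_card Finset.univ u K (fun i _ => (hu i).2)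
      have := Nat.zero_le (D.sup id * K)
      omega
  have hSle : ∀ χ, ‖S χ‖ ^ 2 ≤ (D.card : ℝ) ^ 2 := by
    intro χ
    gcongr
    refine (norm_sum_le_of_le D (f := fun z : ℕ => ((1 : ℝ) : ℂ) * χ (z : ℕ)) (n := fun _ => 1)
      fun z _ => ?_).trans (by simp)
    simpa using χ.norm_le_one z
  have h4 := sum_mul_pow_le Finset.univ (fun χ => ‖S χ‖ ^ 2) (fun χ => ‖F χ‖ ^ 2)
    (fun _ _ => by positivity) (fun _ _ => by positivity) (by rw [h1]; positivity) k
  rw [h1, h2] at h4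
  set V := ∑ u ∈ Fintype.piFinset (fun _ : Fin (k + 1) => Finset.Icc 1 K),
          ∑ v ∈ Fintype.piFinset (fun _ : Fin (k + 1) => Finset.Icc 1 K),
            if ∏ i, u i = ∏ i, v i then (∏ i, c (u i)) * ∏ i, c (v i) else 0
  set T := ∑ x ∈ D ×ˢ Finset.Icc 1 K, ∑ y ∈ D ×ˢ Finset.Icc 1 K,
        if x.1 * x.2 = y.1 * y.2 then c x.2 * c y.2 else 0
  have h5 : ∑ χ, ‖S χ‖ ^ 2 * (‖F χ‖ ^ 2) ^ (k + 1) ≤ (D.card : ℝ) ^ 2 * (q.totient * V) := by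
    rw [← h3, Finset.mul_sum]
    exact Finset.sum_le_sum fun χ _ => mul_le_mul_of_nonneg_right (hSle χ) (by positivity)
  have h6 : (q.totient : ℝ) ^ (k + 1) * T ^ (k + 1) ≤
      (q.totient : ℝ) ^ (k + 1) * ((D.card : ℝ) ^ (k + 2) * V) := by
    calc _ = (q.totient * T) ^ (k + 1) := by ring
      _ ≤ (q.totient * D.card : ℝ) ^ k * ((D.card : ℝ) ^ 2 * (q.totient * V)) :=
          h4.trans (by gcongr)
      _ = _ := by ring
  exact le_of_mul_le_mul_left h6 (by positivity)

theorem sum_prod_eq_prod_le (K k : ℕ) (B : ℝ) (hK : 1 ≤ K)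
    (hB : ∀ n : ℕ, n ≠ 0 → n ≤ K ^ k → (n.divisors.card : ℝ) ≤ B) :
    (∑ u ∈ Fintype.piFinset (fun _ : Fin k => Finset.Icc 1 K),
      ∑ v ∈ Fintype.piFinset (fun _ : Fin k => Finset.Icc 1 K),
        if ∏ i, u i = ∏ i, v i then
          (∏ i, (Real.sqrt (u i))⁻¹) * ∏ i, (Real.sqrt (v i))⁻¹ else 0) ≤
      ((1 + Real.log K) * B) ^ k := by
  have hB0 : 0 ≤ B := (Nat.cast_nonneg _).trans (hB 1 one_ne_zero (Nat.one_le_pow _ _ hK))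
  have hin : ∀ u ∈ Fintype.piFinset (fun _ : Fin k => Finset.Icc 1 K),
      (∑ v ∈ Fintype.piFinset (fun _ : Fin k => Finset.Icc 1 K),
        if ∏ i, u i = ∏ i, v i then
          (∏ i, (Real.sqrt (u i))⁻¹) * ∏ i, (Real.sqrt (v i))⁻¹ else 0) ≤
      (∏ i, ((u i : ℝ))⁻¹) * B ^ k := by
    intro u hu
    simp only [Fintype.mem_piFinset, Finset.mem_Icc] at hu
    have hprod : ∀ v : Fin k → ℕ, ∏ i, (Real.sqrt (v i))⁻¹ =
        (Real.sqrt ((∏ i, v i : ℕ) : ℝ))⁻¹ := by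
      intro v
      push_cast
      rw [Real.sqrt_prod _ (fun i _ => Nat.cast_nonneg _), Finset.prod_inv_distrib]
    have hn0 : ∏ i, u i ≠ 0 := Finset.prod_ne_zero_iff.2 fun i _ => by have := (hu i).1; omega
    have hnK : ∏ i, u i ≤ K ^ k := by
      simpa using Finset.prod_le_pow_card Finset.univ u K (fun i _ => (hu i).2)
    have hterm : ∀ v : Fin k → ℕ, (if ∏ i, u i = ∏ i, v i then
          (∏ i, (Real.sqrt (u i))⁻¹) * ∏ i, (Real.sqrt (v i))⁻¹ else 0) =
        if ∏ i, u i = ∏ i, v i then ∏ i, ((u i : ℝ))⁻¹ else 0 := by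
      intro v
      split_ifs with h
      · rw [hprod, hprod, ← h, ← mul_inv, Real.mul_self_sqrt (Nat.cast_nonneg _)]
        push_cast
        rw [Finset.prod_inv_distrib]
      · rfl
    simp_rw [hterm]
    rw [← Finset.sum_filter, Finset.sum_const, nsmul_eq_mul, mul_comm]
    gcongr
    calc _ ≤ ((Fintype.piFinset (fun _ : Fin k => (∏ i, u i).divisors)).card : ℝ) := by
          gcongr
          intro v hv
          simp only [Finset.mem_filter] at hv
          simp only [Fintype.mem_piFinset, Nat.mem_divisors]
          exact fun i => ⟨hv.2 ▸ Finset.dvd_prod_of_mem v (Finset.mem_univ i), hn0⟩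
      _ = ((∏ i, u i).divisors.card : ℝ) ^ k := by simp
      _ ≤ B ^ k := by gcongr; exact hB _ hn0 hnK
  refine (Finset.sum_le_sum hin).trans ?_
  rw [← Finset.sum_mul, mul_pow]
  gcongr
  have := Finset.prod_univ_sum (fun _ : Fin k => Finset.Icc 1 K) (fun _ a => ((a : ℝ))⁻¹)
  rw [← this, Finset.prod_const, Finset.card_univ, Fintype.card_fin]
  gcongr
  have h := harmonic_le_one_add_log K
  rw [harmonic_eq_sum_Icc] at h
  push_cast at h
  exact h

theorem natCast_gcd_div_natCast_max {g k l : ℕ} (hg : 0 < g) (hk : 0 < k) (hco : k.Coprime l) :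
    ((Nat.gcd (k * g) (l * g) : ℕ) : ℝ) / ((max (k * g) (l * g) : ℕ) : ℝ) =
      1 / max (k : ℝ) l := by
  have hgR : (0 : ℝ) < g := by exact_mod_cast hg
  have hmax : (0 : ℝ) < max (k : ℝ) l := lt_max_of_lt_left (by exact_mod_cast hk)
  rw [Nat.gcd_mul_right, hco.gcd_eq_one, one_mul]
  push_cast
  rw [← max_mul_of_nonneg _ _ hgR.le]
  field_simp

theorem sum_gcd_div_max_le (D : Finset ℕ) (hD : ∀ z ∈ D, 0 < z) (hne : D.Nonempty) :
    ∑ z ∈ D, ∑ w ∈ D, (Nat.gcd z w : ℝ) / max z w ≤ D.card +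
      ∑ x ∈ D ×ˢ Finset.Icc 1 D.card, ∑ y ∈ D ×ˢ Finset.Icc 1 D.card,
        if x.1 * x.2 = y.1 * y.2 then (Real.sqrt x.2)⁻¹ * (Real.sqrt y.2)⁻¹ else 0 := by
  set M := D.card with hM
  have hM0 : (0 : ℝ) < M := by exact_mod_cast hne.card_pos
  have hterm : ∀ z ∈ D, ∀ w ∈ D, (Nat.gcd z w : ℝ) / max z w ≤ 1 / M +
      ∑ a ∈ Finset.Icc 1 M, ∑ b ∈ Finset.Icc 1 M,
        if z * a = w * b then (Real.sqrt a)⁻¹ * (Real.sqrt b)⁻¹ else 0 := by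
    intro z hz w hw
    obtain ⟨g, k, l, hg, hco, rfl, rfl⟩ := Nat.exists_coprime' (Nat.gcd_pos_of_pos_left w (hD z hz))
    have hk : 0 < k := Nat.pos_of_mul_pos_right (hD _ hz)
    have hl : 0 < l := Nat.pos_of_mul_pos_right (hD _ hw)
    have hkR : (0 : ℝ) < k := by exact_mod_cast hk
    have hval : ((Nat.gcd (k * g) (l * g) : ℕ) : ℝ) / ((max (k * g) (l * g) : ℕ) : ℝ) =
        1 / max (k : ℝ) l :=
      natCast_gcd_div_natCast_max hg hk hco
    rw [hval]
    have hnn : ∀ a b : ℕ, (0 : ℝ) ≤ if k * g * a = l * g * b then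
        (Real.sqrt a)⁻¹ * (Real.sqrt b)⁻¹ else 0 := by
      intro a b
      split_ifs <;> positivity
    by_cases h : k ≤ M ∧ l ≤ M
    · have h1 : (1 : ℝ) / max (k : ℝ) l ≤ (Real.sqrt l)⁻¹ * (Real.sqrt k)⁻¹ := by
        rw [← mul_inv, one_div]
        gcongr
        calc √(l : ℝ) * √(k : ℝ) ≤ √(max (k : ℝ) l) * √(max (k : ℝ) l) := by
              gcongr
              · exact le_max_right _ _
              · exact le_max_left _ _
          _ = _ := Real.mul_self_sqrt (by positivity)
      have h2 : (Real.sqrt l)⁻¹ * (Real.sqrt k)⁻¹ ≤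
          ∑ a ∈ Finset.Icc 1 M, ∑ b ∈ Finset.Icc 1 M,
        if k * g * a = l * g * b then (Real.sqrt a)⁻¹ * (Real.sqrt b)⁻¹ else 0 := by
        refine le_trans ?_ (Finset.single_le_sum (fun a _ => Finset.sum_nonneg fun b _ => hnn a b)
          (Finset.mem_Icc.2 ⟨hl, h.2⟩))
        refine le_trans ?_ (Finset.single_le_sum (fun b _ => hnn l b)
          (Finset.mem_Icc.2 ⟨hk, h.1⟩))
        rw [if_pos (by ring)]
      have : (0 : ℝ) ≤ 1 / M := by positivity
      linarith
    · have h1 : (M : ℝ) ≤ max (k : ℝ) l := by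
        rw [not_and_or, not_le, not_le] at h
        rcases h with h | h
        · exact le_max_of_le_left (by exact_mod_cast h.le)
        · exact le_max_of_le_right (by exact_mod_cast h.le)
      have h2 : 1 / max (k : ℝ) l ≤ 1 / (M : ℝ) := one_div_le_one_div_of_le hM0 h1
      have h3 := Finset.sum_nonneg (s := Finset.Icc 1 M) fun a _ =>
        Finset.sum_nonneg (s := Finset.Icc 1 M) fun b _ => hnn a b
      linarith
  refine (Finset.sum_le_sum fun z hz => Finset.sum_le_sum fun w hw => hterm z hz w hw).trans ?_
  simp only [Finset.sum_add_distrib, Finset.sum_const, ← hM, nsmul_eq_mul]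
  refine add_le_add (by field_simp; rfl) (le_of_eq ?_)
  simp only [Finset.sum_product]
  refine Finset.sum_congr rfl fun z _ => ?_
  rw [Finset.sum_comm]

/-- Gál-type bound: `∑ gcd(z, w) / max(z, w) ≪ M ^ (1 + δ)` over `M` positive integers. -/
theorem exists_sum_gcd_div_max_le {δ : ℝ} (hδ : 0 < δ) :
    ∃ C : ℝ, 0 < C ∧ ∀ D : Finset ℕ, (∀ z ∈ D, 0 < z) → D.Nonempty →
      ∑ z ∈ D, ∑ w ∈ D, (Nat.gcd z w : ℝ) / max z w ≤ C * (D.card : ℝ) ^ (1 + δ) := by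
  obtain ⟨k, hk⟩ := exists_nat_ge (3 / δ)
  have hk1 : (0 : ℝ) < (k + 1 : ℕ) := by positivity
  obtain ⟨C₀, hC₀, hdiv⟩ := exists_card_divisors_le_mul_rpow (η := δ / (3 * (k + 1 : ℕ)))
    (by positivity)
  refine ⟨1 + (1 + 3 / δ) * C₀, by positivity, fun D hD hne => ?_⟩
  refine (sum_gcd_div_max_le D hD hne).trans ?_
  set M := D.card with hM
  have hM1 : 1 ≤ M := hne.card_pos
  have hM1R : (1 : ℝ) ≤ M := by exact_mod_cast hM1
  have hM0 : (0 : ℝ) < M := by linarith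
  have hT := pow_sum_ratio_le D hD hne M k (fun a => (Real.sqrt a)⁻¹)
  have hV := sum_prod_eq_prod_le M (k + 1) (C₀ * (M : ℝ) ^ (δ / 3)) hM1 (by
    intro n hn hnM
    refine (hdiv n hn).trans ?_
    gcongr
    calc (n : ℝ) ^ (δ / (3 * (k + 1 : ℕ))) ≤ ((M : ℝ) ^ (k + 1)) ^ (δ / (3 * (k + 1 : ℕ))) := by
          gcongr
          exact_mod_cast hnM
      _ = (M : ℝ) ^ (δ / 3) := by
          rw [← Real.rpow_natCast, ← Real.rpow_mul hM0.le]
          congr 1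
          field_simp)
  set T := ∑ x ∈ D ×ˢ Finset.Icc 1 M, ∑ y ∈ D ×ˢ Finset.Icc 1 M,
        if x.1 * x.2 = y.1 * y.2 then (Real.sqrt x.2)⁻¹ * (Real.sqrt y.2)⁻¹ else 0
  have hlog : 1 + Real.log M ≤ (1 + 3 / δ) * (M : ℝ) ^ (δ / 3) := by
    have h1 := Real.log_le_rpow_div hM0.le (show 0 < δ / 3 by positivity)
    have h2 : (1 : ℝ) ≤ (M : ℝ) ^ (δ / 3) := Real.one_le_rpow hM1R (by positivity)
    have h3 : (M : ℝ) ^ (δ / 3) / (δ / 3) = 3 / δ * (M : ℝ) ^ (δ / 3) := by field_simp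
    rw [h3] at h1
    linarith
  have hlog0 : 0 ≤ 1 + Real.log M := by
    have := Real.log_nonneg hM1R
    linarith
  have hMpow : (M : ℝ) ^ (k + 2) ≤ ((M : ℝ) ^ (1 + δ / 3)) ^ (k + 1) := by
    rw [← Real.rpow_natCast, ← Real.rpow_natCast, ← Real.rpow_mul hM0.le]
    refine Real.rpow_le_rpow_of_exponent_le hM1R ?_
    rw [div_le_iff₀ hδ] at hk
    push_cast
    nlinarith
  have hTle : T ≤ (1 + 3 / δ) * C₀ * (M : ℝ) ^ (1 + δ) := by
    refine le_of_pow_le_pow_left₀ (n := k + 1) (by omega) (by positivity) ?_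
    calc T ^ (k + 1) ≤ ((M : ℝ) ^ (1 + δ / 3)) ^ (k + 1) *
          ((1 + Real.log M) * (C₀ * (M : ℝ) ^ (δ / 3))) ^ (k + 1) := by
          refine hT.trans ?_
          refine (mul_le_mul_of_nonneg_left hV (by positivity)).trans ?_
          gcongr
      _ ≤ ((M : ℝ) ^ (1 + δ / 3)) ^ (k + 1) *
          (((1 + 3 / δ) * (M : ℝ) ^ (δ / 3)) * (C₀ * (M : ℝ) ^ (δ / 3))) ^ (k + 1) := by
          gcongr
      _ = ((1 + 3 / δ) * C₀ * ((M : ℝ) ^ (1 + δ / 3) * (M : ℝ) ^ (δ / 3) *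
            (M : ℝ) ^ (δ / 3))) ^ (k + 1) := by
          rw [← mul_pow]
          congr 1
          ring
      _ = _ := by
          rw [← Real.rpow_add hM0, ← Real.rpow_add hM0, add_assoc (1 + δ / 3), add_assoc 1,
            show δ / 3 + (δ / 3 + δ / 3) = δ by ring]
  have hMle : (M : ℝ) ≤ (M : ℝ) ^ (1 + δ) := by
    conv_lhs => rw [← Real.rpow_one (M : ℝ)]
    exact Real.rpow_le_rpow_of_exponent_le hM1R (by linarith)
  linarith

theorem measurePreserving_nsmul_unitAddCircle {n : ℕ} (hn : 0 < n) :
    MeasurePreserving (fun x : UnitAddCircle => n • x) volume volume := by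
  rcases Nat.lt_or_ge 1 n with h | h
  · exact (AddCircle.ergodic_nsmul h).toMeasurePreserving
  · obtain rfl : n = 1 := by omega
    simp only [one_smul]
    exact MeasurePreserving.id volume

/-- At most `2 ψ k + 1` multiples of an element of order `k` lie within `ψ` of a given point. -/
theorem card_le_of_norm_sub_nsmul_le {k : ℕ} (hk : 0 < k) {u : UnitAddCircle}
    (hu : addOrderOf u = k) (y : UnitAddCircle) {ψ : ℝ} (hψ : 0 ≤ ψ) (J : Finset ℕ)
    (hJ : ∀ i ∈ J, i < k ∧ ‖y - i • u‖ ≤ ψ) : (J.card : ℝ) ≤ 2 * ψ * k + 1 := by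
  have hkR : (0 : ℝ) < k := by exact_mod_cast hk
  set r : ℝ := 1 / (2 * k) with hr
  have hr0 : 0 < r := by positivity
  have hfin : IsOfFinAddOrder u := addOrderOf_pos_iff.1 (hu ▸ hk)
  have hsep : ∀ i < k, ∀ j < k, i < j → 1 / (k : ℝ) ≤ ‖j • u - i • u‖ := by
    intro i hi j hj hij
    have hsub : j • u - i • u = (j - i) • u := by
      rw [sub_eq_iff_eq_add, ← add_nsmul, Nat.sub_add_cancel hij.le]
    have hne : (j - i) • u ≠ 0 := by
      intro h0
      have := addOrderOf_dvd_of_nsmul_eq_zero h0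
      rw [hu] at this
      have := Nat.le_of_dvd (by omega) this
      omega
    have h1 := AddCircle.le_add_order_smul_norm_of_isOfFinAddOrder (hfin.nsmul (n := j - i)) hne
    have h2 : addOrderOf ((j - i) • u) ≤ k :=
      Nat.le_of_dvd hk (hu ▸ addOrderOf_smul_dvd (j - i))
    rw [hsub, div_le_iff₀ hkR]
    rw [nsmul_eq_mul] at h1
    have h3 : (addOrderOf ((j - i) • u) : ℝ) ≤ k := by exact_mod_cast h2
    nlinarith [norm_nonneg ((j - i) • u)]
  have hdisj : (J : Set ℕ).PairwiseDisjoint fun i => Metric.ball (i • u) r := by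
    intro i hi j hj hij
    have hd : r + r ≤ dist (i • u) (j • u) := by
      have : r + r = 1 / k := by rw [hr]; field_simp; norm_num
      rw [this]
      rcases lt_or_gt_of_ne hij with h | h
      · rw [dist_comm, dist_eq_norm]
        exact hsep i (hJ i hi).1 j (hJ j hj).1 h
      · rw [dist_eq_norm]
        exact hsep j (hJ j hj).1 i (hJ i hi).1 h
    exact Metric.ball_disjoint_ball hd
  have hball : ∀ i ∈ J, (volume : Measure UnitAddCircle).real (Metric.ball (i • u) r) = 1 / k := by
    intro i _
    rw [measureReal_congr AddCircle.closedBall_ae_eq_ball.symm, measureReal_def,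
      AddCircle.volume_closedBall, ENNReal.toReal_ofReal (by positivity), hr]
    have h1 : (1 : ℝ) ≤ k := by exact_mod_cast hk
    have h2 : 2 * (1 / (2 * (k : ℝ))) = 1 / k := by field_simp
    rw [h2, min_eq_right ((div_le_one hkR).2 h1)]
  have hsub : (⋃ i ∈ J, Metric.ball (i • u) r) ⊆ Metric.closedBall y (ψ + r) := by
    intro x hx
    simp only [Set.mem_iUnion, Metric.mem_ball, exists_prop] at hx
    obtain ⟨i, hi, hxi⟩ := hx
    have h1 := (hJ i hi).2
    rw [← dist_eq_norm, dist_comm] at h1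
    rw [Metric.mem_closedBall]
    linarith [dist_triangle x (i • u) y]
  have h1 := measureReal_mono (μ := volume) hsub
  rw [measureReal_biUnion_finset hdisj (fun _ _ => measurableSet_ball),
    Finset.sum_congr rfl hball, Finset.sum_const, nsmul_eq_mul,
    measureReal_def (s := Metric.closedBall _ _), AddCircle.volume_closedBall,
    ENNReal.toReal_ofReal (by positivity)] at h1
  have h2 := h1.trans (min_le_right _ _)
  have h3 : 2 * (ψ + r) = (2 * ψ * k + 1) * (1 / k) := by rw [hr]; field_simp
  rw [h3] at h2
  exact le_of_mul_le_mul_right h2 (by positivity)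

theorem measurableSet_norm_nsmul_le (n : ℕ) (ψ : ℝ) :
    MeasurableSet {x : UnitAddCircle | ‖n • x‖ ≤ ψ} :=
  (isClosed_le (by fun_prop) continuous_const).measurableSet

theorem measureReal_norm_nsmul_le {n : ℕ} (hn : 0 < n) {ψ : ℝ} (hψ : 0 ≤ ψ) (hψ' : ψ ≤ 1 / 2) :
    (volume : Measure UnitAddCircle).real {x | ‖n • x‖ ≤ ψ} = 2 * ψ := by
  have h := (measurePreserving_nsmul_unitAddCircle hn).measureReal_preimage
    (s := Metric.closedBall 0 ψ) Metric.isClosed_closedBall.measurableSet.nullMeasurableSet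
  have h2 : (fun x : UnitAddCircle => n • x) ⁻¹' Metric.closedBall 0 ψ = {x | ‖n • x‖ ≤ ψ} := by
    ext x
    simp
  rw [h2, measureReal_def (s := Metric.closedBall _ _), AddCircle.volume_closedBall,
    ENNReal.toReal_ofReal (by positivity), min_eq_right (by linarith)] at h
  exact h

theorem sum_measureReal_inter_le {X : Type*} [MeasurableSpace X] (μ : Measure X)
    [IsFiniteMeasure μ] {ι : Type*} (s : Finset ι) {E : Set X} (A : ι → Set X) (B : ℝ)
    (hE : MeasurableSet E) (hA : ∀ i, MeasurableSet (A i))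
    (hB : ∀ x ∈ E, ∑ i ∈ s, (A i).indicator (1 : X → ℝ) x ≤ B) :
    ∑ i ∈ s, μ.real (E ∩ A i) ≤ B * μ.real E := by
  have hInt : ∀ i, Integrable ((E ∩ A i).indicator (1 : X → ℝ)) μ := fun i =>
    (integrable_const (1 : ℝ)).indicator (hE.inter (hA i))
  calc ∑ i ∈ s, μ.real (E ∩ A i) = ∑ i ∈ s, ∫ x, (E ∩ A i).indicator (1 : X → ℝ) x ∂μ := by
        refine Finset.sum_congr rfl fun i _ => ?_
        rw [integral_indicator_one (hE.inter (hA i))]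
    _ = ∫ x, ∑ i ∈ s, (E ∩ A i).indicator (1 : X → ℝ) x ∂μ :=
        (integral_finsetSum s fun i _ => hInt i).symm
    _ ≤ ∫ x, B * E.indicator (1 : X → ℝ) x ∂μ := by
        refine integral_mono (integrable_finsetSum s fun i _ => hInt i)
          (((integrable_const (1 : ℝ)).indicator hE).const_mul B) fun x => ?_
        simp only [Set.inter_indicator_one, Pi.mul_apply, ← Finset.mul_sum]
        by_cases hx : x ∈ E
        · simpa [hx] using hB x hx
        · simp [hx]
    _ = B * μ.real E := by
        rw [integral_const_mul, integral_indicator_one hE]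

theorem measureReal_inter_le_of_coprime {k l : ℕ} (hk : 0 < k) (hco : l.Coprime k)
    {ψ : ℝ} (hψ : 0 ≤ ψ) (hψ' : ψ ≤ 1 / 2) :
    (volume : Measure UnitAddCircle).real ({x | ‖k • x‖ ≤ ψ} ∩ {x | ‖l • x‖ ≤ ψ}) ≤
      4 * ψ ^ 2 + 2 * ψ * (1 / k) := by
  have hkR : (0 : ℝ) < k := by exact_mod_cast hk
  set v : UnitAddCircle := ((1 / (k : ℝ) : ℝ) : UnitAddCircle) with hv
  have hkv : k • v = 0 := by
    rw [hv, ← AddCircle.coe_nsmul, nsmul_eq_mul, mul_one_div_cancel hkR.ne', AddCircle.coe_period]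
  have hlv : addOrderOf (l • v) = k := by
    have h := AddCircle.addOrderOf_div_of_gcd_eq_one (p := (1 : ℝ)) hk hco
    rw [mul_one] at h
    rwa [hv, ← AddCircle.coe_nsmul, nsmul_eq_mul, mul_one_div]
  set E : Set UnitAddCircle := {x | ‖k • x‖ ≤ ψ}
  set A : ℕ → Set UnitAddCircle := fun i => {x | ‖l • x - i • (l • v)‖ ≤ ψ} with hA
  have hAm : ∀ i, MeasurableSet (A i) := fun i =>
    (isClosed_le (by fun_prop) continuous_const).measurableSet
  have hEm : MeasurableSet E := measurableSet_norm_nsmul_le k ψ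
  have htrans : ∀ i, (volume : Measure UnitAddCircle).real (E ∩ A i) =
      (volume : Measure UnitAddCircle).real (E ∩ {x | ‖l • x‖ ≤ ψ}) := by
    intro i
    rw [← (measurePreserving_sub_right (volume : Measure UnitAddCircle)
      (i • v)).measureReal_preimage (hEm.inter (measurableSet_norm_nsmul_le l ψ)).nullMeasurableSet]
    congr 1
    ext x
    simp only [E, hA, Set.mem_inter_iff, Set.mem_ofPred_eq, Set.mem_preimage, smul_sub]
    rw [smul_comm k i v, hkv, smul_zero, sub_zero, smul_comm l i v]
  have h := sum_measureReal_inter_le volume (Finset.range k) A (2 * ψ * k + 1) hEm hAm (by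
    intro x _
    have h1 := card_le_of_norm_sub_nsmul_le hk hlv (l • x) hψ
      ((Finset.range k).filter fun i => ‖l • x - i • (l • v)‖ ≤ ψ) (by
        intro i hi
        simpa using hi)
    refine le_trans (le_of_eq ?_) h1
    rw [Finset.card_filter]
    push_cast
    refine Finset.sum_congr rfl fun i _ => ?_
    simp only [Set.indicator_apply, hA, Set.mem_ofPred_eq, Pi.one_apply])
  rw [Finset.sum_congr rfl (fun i _ => htrans i), Finset.sum_const, Finset.card_range,
    nsmul_eq_mul, measureReal_norm_nsmul_le hk hψ hψ'] at h
  have h2 : (2 * ψ * k + 1) * (2 * ψ) = k * (4 * ψ ^ 2 + 2 * ψ * (1 / k)) := by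
    field_simp
    ring
  rw [h2] at h
  exact le_of_mul_le_mul_left h hkR

/-- Overlap estimate: `{‖z x‖ ≤ ψ}` and `{‖w x‖ ≤ ψ}` are independent up to an error of
`2 ψ gcd(z, w) / max(z, w)`. -/
theorem measureReal_inter_le {z w : ℕ} (hz : 0 < z) (hw : 0 < w)
    {ψ : ℝ} (hψ : 0 ≤ ψ) (hψ' : ψ ≤ 1 / 2) :
    (volume : Measure UnitAddCircle).real ({x | ‖z • x‖ ≤ ψ} ∩ {x | ‖w • x‖ ≤ ψ}) ≤
      4 * ψ ^ 2 + 2 * ψ * ((Nat.gcd z w : ℝ) / max z w) := by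
  obtain ⟨g, k, l, hg, hco, rfl, rfl⟩ := Nat.exists_coprime' (Nat.gcd_pos_of_pos_left w hz)
  have hk : 0 < k := Nat.pos_of_mul_pos_right hz
  have hl : 0 < l := Nat.pos_of_mul_pos_right hw
  have hval : ((Nat.gcd (k * g) (l * g) : ℕ) : ℝ) / ((max (k * g) (l * g) : ℕ) : ℝ) =
      1 / max (k : ℝ) l :=
    natCast_gcd_div_natCast_max hg hk hco
  have hpre := (measurePreserving_nsmul_unitAddCircle hg).measureReal_preimage
    (((measurableSet_norm_nsmul_le k ψ).inter
      (measurableSet_norm_nsmul_le l ψ)).nullMeasurableSet)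
  simp only [Set.preimage_inter, Set.preimage_ofPred_eq, ← mul_nsmul'] at hpre
  rw [hval, hpre]
  rcases le_total (k : ℝ) l with h | h
  · rw [max_eq_right h, Set.inter_comm]
    exact measureReal_inter_le_of_coprime hl hco hψ hψ'
  · rw [max_eq_left h]
    exact measureReal_inter_le_of_coprime hk hco.symm hψ hψ'

/-- Second moment bound for the set of points that no `z ∈ D` moves close to `0`. -/
theorem measureReal_forall_lt_norm_le (D : Finset ℕ) (hD : ∀ z ∈ D, 0 < z) (hne : D.Nonempty)
    {ψ : ℝ} (hψ : 0 < ψ) (hψ' : ψ ≤ 1 / 2) :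
    (volume : Measure UnitAddCircle).real {x | ∀ z ∈ D, ψ < ‖z • x‖} ≤
      (∑ z ∈ D, ∑ w ∈ D, (Nat.gcd z w : ℝ) / max z w) / (2 * ψ * (D.card : ℝ) ^ 2) := by
  set T := ∑ z ∈ D, ∑ w ∈ D, (Nat.gcd z w : ℝ) / max z w
  set M : ℝ := (D.card : ℝ) with hM
  have hM0 : 0 < M := Nat.cast_pos.2 hne.card_pos
  set E : ℕ → Set UnitAddCircle := fun z => {x | ‖z • x‖ ≤ ψ} with hE
  have hEm : ∀ z, MeasurableSet (E z) := fun z => measurableSet_norm_nsmul_le z ψ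
  set B : Set UnitAddCircle := {x | ∀ z ∈ D, ψ < ‖z • x‖} with hB
  have hBm : MeasurableSet B := by
    have : B = ⋂ z ∈ D, (E z)ᶜ := by
      ext x
      simp [hB, hE]
    rw [this]
    exact Finset.measurableSet_biInter D fun z _ => (hEm z).compl
  have hInt : ∀ {S : Set UnitAddCircle}, MeasurableSet S →
      Integrable (S.indicator (1 : UnitAddCircle → ℝ)) volume := fun hS =>
    (integrable_const (1 : ℝ)).indicator hS
  set m : ℝ := 2 * ψ * M with hm
  have hI2 : Integrable (fun x => ∑ z ∈ D, ∑ w ∈ D,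
      (E z ∩ E w).indicator (1 : UnitAddCircle → ℝ) x) volume :=
    integrable_finsetSum _ fun z _ => integrable_finsetSum _ fun w _ =>
      hInt ((hEm z).inter (hEm w))
  have hI1 : Integrable (fun x => ∑ z ∈ D,
      (E z).indicator (1 : UnitAddCircle → ℝ) x) volume :=
    integrable_finsetSum _ fun z _ => hInt (hEm z)
  have hpt : ∀ x, m ^ 2 * B.indicator (1 : UnitAddCircle → ℝ) x ≤
      ∑ z ∈ D, ∑ w ∈ D, (E z ∩ E w).indicator (1 : UnitAddCircle → ℝ) x -
        2 * m * ∑ z ∈ D, (E z).indicator (1 : UnitAddCircle → ℝ) x + m ^ 2 := by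
    intro x
    have h1 : ∑ z ∈ D, ∑ w ∈ D, (E z ∩ E w).indicator (1 : UnitAddCircle → ℝ) x =
        (∑ z ∈ D, (E z).indicator (1 : UnitAddCircle → ℝ) x) ^ 2 := by
      rw [sq, Finset.sum_mul_sum]
      simp only [Set.inter_indicator_one, Pi.mul_apply]
    rw [h1]
    by_cases hx : x ∈ B
    · have h0 : ∑ z ∈ D, (E z).indicator (1 : UnitAddCircle → ℝ) x = 0 :=
        Finset.sum_eq_zero fun z hz => Set.indicator_of_notMem (by
          simpa [hE] using hx z hz) _
      rw [h0]
      simp [hx]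
    · rw [Set.indicator_of_notMem hx]
      nlinarith [sq_nonneg (∑ z ∈ D, (E z).indicator (1 : UnitAddCircle → ℝ) x - m)]
  have hmono := integral_mono ((hInt hBm).const_mul (m ^ 2))
    ((hI2.sub (hI1.const_mul (2 * m))).add (integrable_const (m ^ 2))) hpt
  have hsplit := integral_add (hI2.sub (hI1.const_mul (2 * m)))
    (integrable_const (μ := (volume : Measure UnitAddCircle)) (m ^ 2))
  simp only [Pi.sub_apply] at hsplit
  simp only [Pi.add_apply, Pi.sub_apply] at hmono
  rw [hsplit, integral_sub hI2 (hI1.const_mul (2 * m)), integral_const_mul, integral_const_mul,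
    integral_indicator_one hBm, integral_finsetSum _ (fun z _ => hInt (hEm z)),
    integral_finsetSum _ (fun z _ => integrable_finsetSum _ fun w _ =>
      hInt ((hEm z).inter (hEm w))), integral_const] at hmono
  have hsum1 : ∑ z ∈ D, ∫ x, (E z).indicator (1 : UnitAddCircle → ℝ) x = m := by
    rw [Finset.sum_congr rfl fun z hz => (integral_indicator_one (hEm z)).trans
      (measureReal_norm_nsmul_le (hD z hz) hψ.le hψ'), Finset.sum_const, nsmul_eq_mul, hm]
    ring
  have hsum2 : ∑ z ∈ D, ∫ x, ∑ w ∈ D, (E z ∩ E w).indicator (1 : UnitAddCircle → ℝ) x ≤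
      m ^ 2 + 2 * ψ * T := by
    calc _ ≤ ∑ z ∈ D, ∑ w ∈ D, (4 * ψ ^ 2 + 2 * ψ * ((Nat.gcd z w : ℝ) / max z w)) := by
          refine Finset.sum_le_sum fun z hz => ?_
          rw [integral_finsetSum _ (fun w _ => hInt ((hEm z).inter (hEm w)))]
          refine Finset.sum_le_sum fun w hw => ?_
          rw [integral_indicator_one ((hEm z).inter (hEm w))]
          exact measureReal_inter_le (hD z hz) (hD w hw) hψ.le hψ'
      _ = _ := by
          simp only [Finset.sum_add_distrib, Finset.sum_const, ← Finset.mul_sum, nsmul_eq_mul]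
          rw [hm]
          ring
  rw [hsum1] at hmono
  rw [measureReal_def (s := Set.univ), UnitAddCircle.measure_univ, ENNReal.toReal_one,
    one_smul] at hmono
  rw [le_div_iff₀ (by positivity)]
  have h2 : 2 * ψ * (volume.real B * (2 * ψ * M ^ 2)) ≤ 2 * ψ * T := by
    have : 2 * ψ * (volume.real B * (2 * ψ * M ^ 2)) = m ^ 2 * volume.real B := by
      rw [hm]
      ring
    rw [this]
    nlinarith
  exact le_of_mul_le_mul_left h2 (by positivity)

/-- The positive differences of `a 1, …, a N`. -/
def posDiffs (a : ℕ → ℕ) (N : ℕ) : Finset ℕ :=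
  (((Finset.Icc 1 N) ×ˢ (Finset.Icc 1 N)).filter fun p => p.1 < p.2).image
    fun p => a p.2 - a p.1

theorem mem_posDiffs {a : ℕ → ℕ} {N z : ℕ} :
    z ∈ posDiffs a N ↔ ∃ m n, 1 ≤ m ∧ m < n ∧ n ≤ N ∧ a n - a m = z := by
  simp only [posDiffs, Finset.mem_image, Finset.mem_filter, Finset.mem_product, Finset.mem_Icc,
    Prod.exists]
  constructor
  · rintro ⟨m, n, ⟨⟨h1, h2⟩, h3⟩, h4⟩
    exact ⟨m, n, h1.1, h3, h2.2, h4⟩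
  · rintro ⟨m, n, h1, h2, h3, h4⟩
    exact ⟨m, n, ⟨⟨⟨h1, by omega⟩, by omega, h3⟩, h2⟩, h4⟩

theorem card_posDiffs_le (a : ℕ → ℕ) (N : ℕ) : (posDiffs a N).card ≤ N ^ 2 := by
  refine Finset.card_image_le.trans ((Finset.card_filter_le _ _).trans ?_)
  simp [sq]

theorem diffCard_le_sq (a : ℕ → ℕ) (N : ℕ) : diffCard a N ≤ N ^ 2 := by
  refine Finset.card_image_le.trans ?_
  simp [sq]

theorem le_diffCard {a : ℕ → ℕ} (hmono : ∀ m n, 1 ≤ m → m < n → a m < a n) (N : ℕ) :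
    N ≤ diffCard a N := by
  have hinj : Set.InjOn (fun n : ℕ => (a n : ℤ) - (a 1 : ℤ)) (Finset.Icc 1 N : Finset ℕ) := by
    intro m hm n hn h
    simp only [Finset.coe_Icc, Set.mem_Icc] at hm hn
    rcases lt_trichotomy m n with h1 | h1 | h1
    · have := hmono m n hm.1 h1
      simp only at h
      omega
    · exact h1
    · have := hmono n m hn.1 h1
      simp only at h
      omega
  calc N = ((Finset.Icc 1 N).image fun n : ℕ => (a n : ℤ) - (a 1 : ℤ)).card := by
        rw [Finset.card_image_of_injOn hinj]
        simp
    _ ≤ diffCard a N := by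
        refine Finset.card_le_card fun x hx => ?_
        simp only [Finset.mem_image, Finset.mem_Icc, Finset.mem_product, Prod.exists] at hx ⊢
        obtain ⟨n, hn, rfl⟩ := hx
        exact ⟨n, 1, ⟨hn, le_rfl, by omega⟩, rfl⟩

theorem diffCard_le {a : ℕ → ℕ} (hmono : ∀ m n, 1 ≤ m → m < n → a m < a n) (N : ℕ) :
    diffCard a N ≤ 2 * (posDiffs a N).card + 1 := by
  have hsub : ((Finset.Icc 1 N) ×ˢ (Finset.Icc 1 N)).image
      (fun p : ℕ × ℕ => (a p.1 : ℤ) - (a p.2 : ℤ)) ⊆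
      ((posDiffs a N).image (fun z : ℕ => (z : ℤ)) ∪
        (posDiffs a N).image (fun z : ℕ => -(z : ℤ))) ∪ {0} := by
    intro x hx
    simp only [Finset.mem_image, Finset.mem_Icc, Finset.mem_product, Prod.exists] at hx
    obtain ⟨m, n, ⟨hm, hn⟩, rfl⟩ := hx
    simp only [Finset.mem_union, Finset.mem_image, Finset.mem_singleton]
    rcases lt_trichotomy m n with h | rfl | h
    · have := hmono m n hm.1 h
      exact Or.inl (Or.inr ⟨_, mem_posDiffs.2 ⟨m, n, hm.1, h, hn.2, rfl⟩, by omega⟩)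
    · exact Or.inr (sub_self _)
    · have := hmono n m hn.1 h
      exact Or.inl (Or.inl ⟨_, mem_posDiffs.2 ⟨n, m, hn.1, h, hm.2, rfl⟩, by omega⟩)
  refine (Finset.card_le_card hsub).trans ((Finset.card_union_le _ _).trans ?_)
  have h1 := Finset.card_union_le ((posDiffs a N).image (fun z : ℕ => (z : ℤ)))
    ((posDiffs a N).image (fun z : ℕ => -(z : ℤ)))
  have h2 := Finset.card_image_le (s := posDiffs a N) (f := fun z : ℕ => (z : ℤ))
  have h3 := Finset.card_image_le (s := posDiffs a N) (f := fun z : ℕ => -(z : ℤ))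
  simp only [Finset.card_singleton]
  omega

theorem deltaMin_le_norm {a : ℕ → ℕ} (hmono : ∀ m n, 1 ≤ m → m < n → a m < a n) {N z : ℕ}
    (hz : z ∈ posDiffs a N) (α : ℝ) : deltaMin a α N ≤ ‖z • (α : UnitAddCircle)‖ := by
  obtain ⟨m, n, hm, hmn, hn, rfl⟩ := mem_posDiffs.1 hz
  refine csInf_le ⟨0, ?_⟩ ⟨n, m, by omega, hn, hm, by omega, by omega, ?_⟩
  · rintro x ⟨_, _, _, _, _, _, _, rfl⟩
    exact abs_nonneg _
  · rw [← AddCircle.coe_nsmul, UnitAddCircle.norm_eq, nsmul_eq_mul,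
      Nat.cast_sub (hmono m n hm hmn).le]
    rfl

theorem posDiffs_mono (a : ℕ → ℕ) {N N' : ℕ} (h : N ≤ N') : posDiffs a N ⊆ posDiffs a N' := by
  intro z hz
  obtain ⟨m, n, h1, h2, h3, h4⟩ := mem_posDiffs.1 hz
  exact mem_posDiffs.2 ⟨m, n, h1, h2, h3.trans h, h4⟩

/-- The exceptional set for a single `N` has measure `≪ N ^ (-ε / 2)`. -/
theorem exists_measureReal_exceptional_le {ε : ℝ} (hε : 0 < ε) :
    ∃ C : ℝ, 0 < C ∧ ∀ a : ℕ → ℕ, (∀ m n, 1 ≤ m → m < n → a m < a n) → ∀ N : ℕ, 2 ≤ N →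
      (volume : Measure UnitAddCircle).real
        {x | ∀ z ∈ posDiffs a N, (N : ℝ) ^ ε / diffCard a N < ‖z • x‖} ≤
        C * (N : ℝ) ^ (-(ε / 2)) := by
  obtain ⟨C, hC, hgcd⟩ := exists_sum_gcd_div_max_le (δ := ε / 4) (by positivity)
  refine ⟨3 * C / 2, by positivity, fun a hmono N hN => ?_⟩
  have hN0 : (0 : ℝ) < N := by positivity
  have hpos : ∀ z ∈ posDiffs a N, 0 < z := by
    intro z hz
    obtain ⟨m, n, hm, hmn, hn, rfl⟩ := mem_posDiffs.1 hz
    exact Nat.sub_pos_of_lt (hmono m n hm hmn)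
  have hne : (posDiffs a N).Nonempty :=
    ⟨_, mem_posDiffs.2 ⟨1, 2, le_rfl, by omega, hN, rfl⟩⟩
  have hd0 : 0 < diffCard a N := lt_of_lt_of_le (by omega) (le_diffCard hmono N)
  have hd0R : (0 : ℝ) < diffCard a N := by exact_mod_cast hd0
  set ψ : ℝ := (N : ℝ) ^ ε / diffCard a N with hψ
  have hψ0 : 0 < ψ := by positivity
  rcases le_or_gt ψ (1 / 2) with hle | hgt
  · refine (measureReal_forall_lt_norm_le _ hpos hne hψ0 hle).trans ?_
    have h1 := hgcd _ hpos hne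
    have hM1 : 1 ≤ (posDiffs a N).card := hne.card_pos
    have hdM : diffCard a N ≤ 3 * (posDiffs a N).card := by
      have := diffCard_le hmono N
      omega
    have hMN := card_posDiffs_le a N
    set M := (posDiffs a N).card
    have hM0 : (0 : ℝ) < M := by exact_mod_cast hM1
    have hdMR : (diffCard a N : ℝ) ≤ 3 * M := by exact_mod_cast hdM
    have hMNR : (M : ℝ) ≤ (N : ℝ) ^ 2 := by exact_mod_cast hMN
    have hMpow : (M : ℝ) ^ (ε / 4) ≤ (N : ℝ) ^ (ε / 2) := by
      calc (M : ℝ) ^ (ε / 4) ≤ ((N : ℝ) ^ 2) ^ (ε / 4) := by gcongr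
        _ = (N : ℝ) ^ (ε / 2) := by
          rw [← Real.rpow_natCast, ← Real.rpow_mul hN0.le]
          congr 1
          push_cast
          ring
    calc _ ≤ C * (M : ℝ) ^ (1 + ε / 4) / (2 * ψ * (M : ℝ) ^ 2) := by gcongr
      _ = C / 2 * (M : ℝ) ^ (ε / 4) * (diffCard a N / M) / (N : ℝ) ^ ε := by
          rw [Real.rpow_add hM0, Real.rpow_one, hψ]
          field_simp
      _ ≤ C / 2 * (N : ℝ) ^ (ε / 2) * 3 / (N : ℝ) ^ ε := by
          gcongr
          rwa [div_le_iff₀ hM0]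
      _ = 3 * C / 2 * (N : ℝ) ^ (-(ε / 2)) := by
          have : (N : ℝ) ^ (-(ε / 2)) = (N : ℝ) ^ (ε / 2) / (N : ℝ) ^ ε := by
            rw [← Real.rpow_sub hN0]
            congr 1
            ring
          rw [this]
          ring
  · have hempty : {x : UnitAddCircle | ∀ z ∈ posDiffs a N, ψ < ‖z • x‖} = ∅ := by
      refine Set.eq_empty_of_forall_notMem fun x hx => ?_
      obtain ⟨z, hz⟩ := hne
      have h1 := hx z hz
      have h2 := AddCircle.norm_le_half_period (p := (1 : ℝ)) (x := z • x) one_ne_zero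
      rw [abs_one] at h2
      linarith
    rw [hempty, measureReal_empty]
    positivity

theorem ae_unitAddCircle_iff_ae_Icc {p : UnitAddCircle → Prop} (h : ∀ᵐ x, p x) :
    ∀ᵐ α : ℝ, α ∈ Set.Icc (0 : ℝ) 1 → p (α : UnitAddCircle) := by
  have h1 := (UnitAddCircle.measurePreserving_mk 0).quasiMeasurePreserving.ae h
  rw [zero_add, restrict_Ioc_eq_restrict_Icc] at h1
  exact (ae_restrict_iff' measurableSet_Icc).1 h1

theorem stmt3 (a : ℕ → ℕ)
    (hpos : ∀ n, 1 ≤ n → 0 < a n)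
    (hmono : ∀ m n, 1 ≤ m → m < n → a m < a n)
    (ε : ℝ) (hε : 0 < ε) :
    ∀ᵐ α ∂(volume : Measure ℝ), α ∈ Set.Icc (0 : ℝ) 1 →
      ∀ᶠ N in atTop, deltaMin a α N ≤ (N : ℝ) ^ ε / (diffCard a N : ℝ) := by
  obtain ⟨C, hC, hbad⟩ := exists_measureReal_exceptional_le (ε := ε / 2) (by positivity)
  have hex : ∀ j : ℕ, ∃ N, 2 ^ (j + 1) ≤ diffCard a N := fun j => ⟨_, le_diffCard hmono _⟩
  set f : ℕ → ℕ := fun j => Nat.find (hex j) with hf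
  have hf1 : ∀ j, 2 ^ (j + 1) ≤ diffCard a (f j) := fun j => Nat.find_spec (hex j)
  have hf2 : ∀ j, 2 ^ (j + 1) ≤ f j ^ 2 := fun j => (hf1 j).trans (diffCard_le_sq a _)
  have hf3 : ∀ j, 2 ≤ f j := by
    intro j
    by_contra hlt
    have h1 : f j ^ 2 ≤ 1 := by
      have : f j ≤ 1 := by omega
      calc f j ^ 2 ≤ 1 ^ 2 := by gcongr
        _ = 1 := one_pow 2
    have h2 := hf2 j
    have h3 : 2 ≤ 2 ^ (j + 1) := by
      rw [pow_succ]
      have := Nat.one_le_two_pow (n := j)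
      omega
    omega
  set B : ℕ → Set UnitAddCircle := fun j =>
    {x | ∀ z ∈ posDiffs a (f j), (f j : ℝ) ^ (ε / 2) / diffCard a (f j) < ‖z • x‖} with hB
  set r : ℝ := (2 : ℝ) ^ (-(ε / 8)) with hr
  have hr1 : r < 1 := Real.rpow_lt_one_of_one_lt_of_neg (by norm_num) (by linarith)
  have hr0 : 0 ≤ r := by positivity
  have hBle : ∀ j, (volume : Measure UnitAddCircle) (B j) ≤ ENNReal.ofReal (C * r ^ j) := by
    intro j
    rw [← ofReal_measureReal]
    refine ENNReal.ofReal_le_ofReal ((hbad a hmono (f j) (hf3 j)).trans ?_)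
    gcongr
    have h1 : (2 : ℝ) ^ j ≤ (f j : ℝ) ^ 2 := by
      have h := hf2 j
      rw [pow_succ] at h
      exact_mod_cast (by omega : 2 ^ j ≤ f j ^ 2)
    calc (f j : ℝ) ^ (-(ε / 2 / 2)) = ((f j : ℝ) ^ 2) ^ (-(ε / 8)) := by
          rw [← Real.rpow_natCast, ← Real.rpow_mul (by positivity)]
          congr 1
          push_cast
          ring
      _ ≤ ((2 : ℝ) ^ j) ^ (-(ε / 8)) :=
          Real.rpow_le_rpow_of_nonpos (by positivity) h1 (by linarith)
      _ = r ^ j := by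
          rw [hr, ← Real.rpow_natCast, ← Real.rpow_natCast, ← Real.rpow_mul (by norm_num),
            ← Real.rpow_mul (by norm_num), mul_comm]
  have hsum : ∑' j, (volume : Measure UnitAddCircle) (B j) ≠ ⊤ :=
    ne_top_of_le_ne_top
      ((summable_geometric_of_lt_one hr0 hr1).mul_left C).tsum_ofReal_ne_top
      (ENNReal.tsum_le_tsum hBle)
  have htwo : ∀ᶠ N : ℕ in atTop, (2 : ℝ) ≤ (N : ℝ) ^ (ε / 2) :=
    ((tendsto_rpow_atTop (by positivity)).comp tendsto_natCast_atTop_atTop).eventually_ge_atTop 2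
  filter_upwards [ae_unitAddCircle_iff_ae_Icc (ae_eventually_notMem hsum)] with α hα hα01
  obtain ⟨J, hJ⟩ := eventually_atTop.1 (hα hα01)
  filter_upwards [htwo, eventually_ge_atTop (2 ^ (J + 1))] with N hN2 hNJ
  have hdN : 2 ^ (J + 1) ≤ diffCard a N := hNJ.trans (le_diffCard hmono N)
  have hd0 : diffCard a N ≠ 0 := by
    have := Nat.one_le_two_pow (n := J + 1)
    omega
  have hlog : J + 1 ≤ Nat.log 2 (diffCard a N) := Nat.le_log_of_pow_le (by norm_num) hdN
  obtain ⟨j, hj⟩ : ∃ j, Nat.log 2 (diffCard a N) = j + 1 :=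
    ⟨_, (Nat.sub_add_cancel (by omega)).symm⟩
  have hle : 2 ^ (j + 1) ≤ diffCard a N := hj ▸ Nat.pow_log_le_self 2 hd0
  have hlt : diffCard a N < 2 ^ (j + 2) := by
    have := Nat.lt_pow_succ_log_self (b := 2) (by norm_num) (diffCard a N)
    rwa [hj] at this
  have hfN : f j ≤ N := Nat.find_min' (hex j) hle
  have hx := hJ j (by omega)
  simp only [hB, Set.mem_ofPred_eq, not_forall, not_lt] at hx
  obtain ⟨z, hz, hzle⟩ := hx
  have hN0 : (0 : ℝ) < N := by
    have := hf3 j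
    exact_mod_cast (by omega : 0 < N)
  have hdf : (diffCard a N : ℝ) ≤ 2 * diffCard a (f j) := by
    have h1 := hf1 j
    rw [pow_succ] at hlt
    exact_mod_cast (by omega : diffCard a N ≤ 2 * diffCard a (f j))
  have hd0R : (0 : ℝ) < diffCard a N := by exact_mod_cast Nat.pos_of_ne_zero hd0
  calc deltaMin a α N ≤ ‖z • (α : UnitAddCircle)‖ :=
        deltaMin_le_norm hmono (posDiffs_mono a hfN hz) α
    _ ≤ (f j : ℝ) ^ (ε / 2) / diffCard a (f j) := hzle
    _ ≤ (N : ℝ) ^ (ε / 2) / (diffCard a N / 2) := by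
        gcongr
        linarith
    _ = (N : ℝ) ^ (ε / 2) * 2 / diffCard a N := by field_simp
    _ ≤ (N : ℝ) ^ (ε / 2) * (N : ℝ) ^ (ε / 2) / diffCard a N := by gcongr
    _ = (N : ℝ) ^ ε / diffCard a N := by
        rw [← Real.rpow_add hN0, add_halves]
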